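/- Fix n ≥ 1. Let S = ℤ[t₁^{±1}, …, tₙ^{±1}] and R = ℤ[t₁^{±1}, …, tₙ^{±1}, z₁^{±1}, …, zₙ^{±1}] be Laurent polynomial rings, and let I ⊆ R be the ideal generated by eₖ(z₁, …, zₙ) − eₖ(t₁, …, tₙ) for k = 1, …, n, where eₖ is the k-th elementary symmetric polynomial. For each w ∈ Sₙ, let ev_w : R/I → S be the ring homomorphism induced by tᵢ ↦ tᵢ and zᵢ ↦ t_{w(i)} (well-defined since each generator of I maps to 0). Then the ring homomorphism L : R/I → ∏_{w ∈ Sₙ} S whose w-th component is ev_w is injective. -/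

import Mathlib

/-- The `k`-th elementary symmetric polynomial of a finite family `v` of elements of a
commutative ring. -/
noncomputable def esymmOf {ι R : Type*} [Fintype ι] [CommRing R] (v : ι → R) (k : ℕ) : R :=
  ∑ A ∈ Finset.powersetCard k (Finset.univ : Finset ι), ∏ i ∈ A, v i

/-- The Laurent polynomial ring `ℤ[t₁^{±1},…,tₙ^{±1}]`, realized as the group algebra of `ℤⁿ`
over `ℤ`. -/
abbrev LaurentS (n : ℕ) : Type := AddMonoidAlgebra ℤ (Fin n → ℤ)

/-- The Laurent polynomial ring `ℤ[t₁^{±1},…,tₙ^{±1},z₁^{±1},…,zₙ^{±1}]`. -/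
abbrev LaurentR (n : ℕ) : Type := AddMonoidAlgebra ℤ (Fin n ⊕ Fin n → ℤ)

/-- The Laurent variable `tᵢ` in `ℤ[t₁^{±1},…,tₙ^{±1}]`. -/
noncomputable def tS {n : ℕ} (i : Fin n) : LaurentS n :=
  AddMonoidAlgebra.single (Pi.single i 1) 1

/-- The Laurent variable `tᵢ` in `ℤ[t^{±1},z^{±1}]`. -/
noncomputable def tR {n : ℕ} (i : Fin n) : LaurentR n :=
  AddMonoidAlgebra.single (Pi.single (Sum.inl i) 1) 1

/-- The Laurent variable `zᵢ` in `ℤ[t^{±1},z^{±1}]`. -/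
noncomputable def zR {n : ℕ} (i : Fin n) : LaurentR n :=
  AddMonoidAlgebra.single (Pi.single (Sum.inr i) 1) 1

/-- The ideal of `ℤ[t^{±1},z^{±1}]` generated by `eₖ(z) − eₖ(t)` for `k = 1, …, n`. -/
noncomputable def borelIdealK (n : ℕ) : Ideal (LaurentR n) :=
  Ideal.span (Set.range fun k : Fin n =>
    esymmOf zR ((k : ℕ) + 1) - esymmOf tR ((k : ℕ) + 1))

/-- `ev` is the family of localization maps: for each permutation `w`, `ev w` is the ring
homomorphism `R/I → S` induced by `tᵢ ↦ tᵢ` and `zᵢ ↦ t_{w(i)}`. -/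
def IsLocalizationFamilyK (n : ℕ)
    (ev : Equiv.Perm (Fin n) → (LaurentR n ⧸ borelIdealK n) →+* LaurentS n) : Prop :=
  ∀ (w : Equiv.Perm (Fin n)) (i : Fin n),
    ev w (Ideal.Quotient.mk (borelIdealK n) (tR i)) = tS i ∧
    ev w (Ideal.Quotient.mk (borelIdealK n) (zR i)) = tS (w i)

/-- The exponent vectors `a` with `aᵢ ≤ i` for all `i`. -/
abbrev StaircaseExponent (n : ℕ) : Type := ∀ i : Fin n, Fin ((i : ℕ) + 1)

/-- The monomial `∏ xᵢ ^ aᵢ` attached to a staircase exponent vector. -/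
def staircaseMonomial {n : ℕ} {A : Type*} [CommRing A] (x : Fin n → A)
    (a : StaircaseExponent n) : A :=
  ∏ i, x i ^ (a i : ℕ)

/-- Append a last exponent to a staircase exponent vector. -/
def StaircaseExponent.snoc {n : ℕ} (b : StaircaseExponent n) (j : Fin (n + 1)) :
    StaircaseExponent (n + 1) :=
  Fin.snoc (α := fun i : Fin (n + 1) => Fin ((i : ℕ) + 1)) b j

lemma StaircaseExponent.exists_eq_snoc {n : ℕ} (a : StaircaseExponent (n + 1)) :
    ∃ (b : StaircaseExponent n) (j : Fin (n + 1)), a = b.snoc j :=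
  ⟨fun i => a i.castSucc, a (Fin.last n), (Fin.snoc_init_self a).symm⟩

lemma StaircaseExponent.sum_succ {n : ℕ} {A : Type*} [AddCommMonoid A]
    (f : StaircaseExponent (n + 1) → A) :
    ∑ a, f a = ∑ b : StaircaseExponent n, ∑ j : Fin (n + 1), f (b.snoc j) := by
  rw [← (Fin.snocEquiv fun i : Fin (n + 1) => Fin ((i : ℕ) + 1)).sum_comp,
    Fintype.sum_prod_type_right]
  rfl

lemma staircaseMonomial_snoc {n : ℕ} {A : Type*} [CommRing A] (x : Fin (n + 1) → A)
    (b : StaircaseExponent n) (j : Fin (n + 1)) :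
    staircaseMonomial x (b.snoc j) =
      staircaseMonomial (fun i => x i.castSucc) b * x (Fin.last n) ^ (j : ℕ) := by
  simp [staircaseMonomial, StaircaseExponent.snoc, Fin.prod_univ_castSucc]

/-- A polynomial supported on staircase exponents which vanishes at every arrangement of the
elements of an `n`-element subset of a domain is zero. -/
lemma staircase_coeff_eq_zero {S : Type*} [CommRing S] [IsDomain S] :
    ∀ (n : ℕ) (T : Finset S), T.card = n → ∀ c : StaircaseExponent n → S,
      (∀ y : Fin n → S, Function.Injective y → (∀ i, y i ∈ T) →
        ∑ a, c a * staircaseMonomial y a = 0) → ∀ a, c a = 0 := by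
  classical
  intro n
  induction n with
  | zero =>
    intro T _ c h a
    have := h Fin.elim0 (fun i => i.elim0) (fun i => i.elim0)
    rw [Fintype.sum_unique, staircaseMonomial, Finset.univ_eq_empty, Finset.prod_empty,
      mul_one] at this
    exact (congrArg c (Subsingleton.elim _ _)).trans this
  | succ n ih =>
    intro T hT c h a
    have key : ∀ s ∈ T, ∀ b : StaircaseExponent n,
        ∑ j : Fin (n + 1), s ^ (j : ℕ) * c (b.snoc j) = 0 := by
      intro s hs
      refine ih (T.erase s) (by rw [Finset.card_erase_of_mem hs, hT]; rfl)
        (fun b => ∑ j : Fin (n + 1), s ^ (j : ℕ) * c (b.snoc j)) ?_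
      intro y hy hyT
      have hy' := h (Fin.snoc y s) (Fin.snoc_injective_iff.2 ⟨hy, ?_⟩) ?_
      · rw [StaircaseExponent.sum_succ] at hy'
        rw [← hy']
        refine Finset.sum_congr rfl fun b _ => ?_
        rw [Finset.sum_mul]
        refine Finset.sum_congr rfl fun j _ => ?_
        rw [staircaseMonomial_snoc]
        simp only [Fin.snoc_castSucc, Fin.snoc_last]
        ring
      · rintro ⟨i, hi⟩
        exact (Finset.mem_erase.1 (hyT i)).1 hi
      · intro i
        refine Fin.lastCases ?_ (fun i => ?_) i
        · simpa using hs
        · simpa using Finset.mem_of_mem_erase (hyT i)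
    obtain ⟨b, j, rfl⟩ := a.exists_eq_snoc
    let e : Fin (n + 1) ≃ T := (T.equivFinOfCardEq hT).symm
    exact congrFun (Matrix.eq_zero_of_forall_index_sum_pow_mul_eq_zero
      (f := fun i => (e i : S)) (v := fun j => c (b.snoc j))
      (Subtype.val_injective.comp e.injective) fun i => key _ (e i).2 b) j

open Polynomial in
/-- If `p` is monic of degree `n` and `p(x) = 0`, then every polynomial expression in `x`
is a linear combination of `1, x, …, x ^ (n - 1)`. -/
lemma exists_eq_sum_pow_of_mem_adjoin_singleton {S A : Type*} [CommRing S] [CommRing A]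
    [Algebra S A] {n : ℕ} {p : S[X]} (hp : p.Monic) (hn : p.natDegree = n) {x : A}
    (hx : aeval x p = 0) {f : A} (hf : f ∈ Algebra.adjoin S {x}) :
    ∃ c : Fin n → S, f = ∑ j, algebraMap S A (c j) * x ^ (j : ℕ) := by
  rw [Algebra.adjoin_singleton_eq_range_aeval] at hf
  obtain ⟨q, rfl⟩ := hf
  refine ⟨fun j => (q %ₘ p).coeff j, ?_⟩
  have hdeg : p.degree ≤ (n : WithBot ℕ) := hn ▸ degree_le_natDegree
  change aeval x q = _
  rw [← aeval_modByMonic_eq_self_of_root hx,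
    ← sum_modByMonic_coeff hp hdeg, map_sum]
  simp [aeval_monomial, sum_modByMonic_coeff hp hdeg]

lemma adjoin_le_restrictScalars_adjoin_castSucc {n : ℕ} {S A : Type*} [CommRing S] [CommRing A]
    [Algebra S A] (x : Fin (n + 1) → A) {B : Subalgebra S A} (u : B)
    (hu : (u : A) = x (Fin.last n)) :
    Algebra.adjoin S (Set.range x) ≤
      (Algebra.adjoin B (Set.range fun i : Fin n => x i.castSucc)).restrictScalars S := by
  refine Algebra.adjoin_le ?_
  rintro _ ⟨i, rfl⟩
  induction i using Fin.lastCases with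
  | last =>
    have h : algebraMap B A u ∈ Algebra.adjoin B (Set.range fun i : Fin n => x i.castSucc) :=
      Subalgebra.algebraMap_mem _ u
    rw [SetLike.mem_coe, Subalgebra.mem_restrictScalars, ← hu]
    exact h
  | cast i =>
    rw [SetLike.mem_coe, Subalgebra.mem_restrictScalars]
    exact Algebra.subset_adjoin (Set.mem_range_self i)

open Polynomial in
/-- If the `xᵢ` generate `A` over `S` and `∏ (X - xᵢ)` has coefficients in `S`, then the staircase
monomials in the `xᵢ` span `A` over `S`. -/
lemma exists_eq_sum_staircaseMonomial.{u} {A : Type u} [CommRing A] :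
    ∀ (n : ℕ) {S : Type u} [CommRing S] [Algebra S A] (x : Fin n → A) (p : S[X]), p.Monic →
      p.natDegree = n → p.map (algebraMap S A) = ∏ i, (X - C (x i)) →
      ∀ f ∈ Algebra.adjoin S (Set.range x), ∃ c : StaircaseExponent n → S,
        f = ∑ a, algebraMap S A (c a) * staircaseMonomial x a := by
  intro n
  induction n with
  | zero =>
    intro S _ _ x p _ _ _ f hf
    rw [Set.range_eq_empty, Algebra.adjoin_empty] at hf
    obtain ⟨s, rfl⟩ := Algebra.mem_bot.1 hf
    exact ⟨fun _ => s, by simp [staircaseMonomial]⟩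
  | succ n ih =>
    intro S _ _ x p hp hpn hpx f hf
    let B : Subalgebra S A := Algebra.adjoin S {x (Fin.last n)}
    let u : B := ⟨x (Fin.last n), Algebra.subset_adjoin rfl⟩
    have hu : algebraMap B A u = x (Fin.last n) := rfl
    have hroot : aeval (x (Fin.last n)) p = 0 := by
      rw [aeval_def, ← eval_map, hpx, eval_prod]
      exact Finset.prod_eq_zero (Finset.mem_univ (Fin.last n)) (by simp)
    have hrootB : (p.map (algebraMap S B)).IsRoot u := by
      rw [IsRoot, eval_map_algebraMap]
      exact Subtype.val_injective ((aeval_algHom_apply B.val u p).symm.trans hroot)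
    let q : B[X] := p.map (algebraMap S B) /ₘ (X - C u)
    have hq : (X - C u) * q = p.map (algebraMap S B) := mul_divByMonic_eq_iff_isRoot.2 hrootB
    have hqm : q.Monic := (monic_X_sub_C u).of_mul_monic_left (hq ▸ hp.map _)
    rcases subsingleton_or_nontrivial A with hA | hA
    · exact ⟨0, Subsingleton.elim _ _⟩
    have hqn : q.natDegree = n := by
      rw [natDegree_divByMonic _ (monic_X_sub_C u), hp.natDegree_map, hpn, natDegree_X_sub_C]
      rfl
    have hqx : q.map (algebraMap B A) = ∏ i : Fin n, (X - C (x i.castSucc)) := by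
      apply (monic_X_sub_C (x (Fin.last n))).isRegular.left
      have := congrArg (Polynomial.map (algebraMap B A)) hq
      rw [Polynomial.map_mul, Polynomial.map_map, ← IsScalarTower.algebraMap_eq, hpx,
        Fin.prod_univ_castSucc, mul_comm (∏ i : Fin n, _)] at this
      simpa [hu] using this
    have hfB : f ∈ Algebra.adjoin B (Set.range fun i : Fin n => x i.castSucc) := by
      have hle := adjoin_le_restrictScalars_adjoin_castSucc x u hu
      exact (Subalgebra.mem_restrictScalars S).1 (hle hf)
    obtain ⟨c, hc⟩ := ih (fun i => x i.castSucc) q hqm hqn hqx f hfB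
    choose d hd using fun b => exists_eq_sum_pow_of_mem_adjoin_singleton hp hpn hroot (c b).2
    refine ⟨fun a => d (fun i => a i.castSucc) (a (Fin.last n)), ?_⟩
    rw [hc, StaircaseExponent.sum_succ]
    refine Finset.sum_congr rfl fun b _ => ?_
    have : algebraMap B A (c b) = _ := hd b
    rw [this, Finset.sum_mul]
    refine Finset.sum_congr rfl fun j _ => ?_
    rw [staircaseMonomial_snoc]
    simp only [StaircaseExponent.snoc, Fin.snoc_castSucc, Fin.snoc_last]
    ring

open Polynomial in
/-- If the `xᵢ` generate `A` over the domain `S` and `∏ (X - xᵢ) = ∏ (X - tᵢ)` with distinct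
`tᵢ ∈ S`, then the evaluations `xᵢ ↦ t_{w(i)}` are jointly injective. -/
lemma eq_zero_of_forall_perm_eval_eq_zero.{u} {n : ℕ} {S A : Type u} [CommRing S] [IsDomain S]
    [CommRing A] [Algebra S A] {t : Fin n → S} (ht : Function.Injective t) {x : Fin n → A}
    (hx : ∏ i, (X - C (x i)) = ∏ i, (X - C (algebraMap S A (t i))))
    (hgen : Algebra.adjoin S (Set.range x) = ⊤) {ev : Equiv.Perm (Fin n) → A →+* S}
    (ev_base : ∀ w s, ev w (algebraMap S A s) = s) (ev_x : ∀ w i, ev w (x i) = t (w i))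
    {f : A} (hf : ∀ w, ev w f = 0) : f = 0 := by
  classical
  obtain ⟨c, rfl⟩ := exists_eq_sum_staircaseMonomial n x (∏ i, (X - C (t i)))
    (monic_prod_X_sub_C t _) (by simp) (by rw [hx, Polynomial.map_prod]; simp) f
    (hgen ▸ Algebra.mem_top)
  suffices h : ∀ a, c a = 0 by simp [h]
  refine staircase_coeff_eq_zero n (Finset.univ.image t)
    (by rw [Finset.card_image_of_injective _ ht, Finset.card_fin]) c fun y hy hyT => ?_
  choose w hw using fun i => (Finset.mem_image.1 (hyT i))
  have hwinj : Function.Injective w := fun i j hij => hy (by rw [← (hw i).2, hij, (hw j).2])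
  rw [← hf (Equiv.ofBijective w (Finite.injective_iff_bijective.1 hwinj)), map_sum]
  refine Finset.sum_congr rfl fun a _ => ?_
  rw [map_mul, ev_base, staircaseMonomial, staircaseMonomial, map_prod]
  simp [ev_x, hw]

open Polynomial in
/-- `∏ (X - vᵢ)` only depends on the elementary symmetric polynomials in the `vᵢ`. -/
lemma prod_X_sub_C_eq_of_esymmOf_eq {n : ℕ} {A : Type*} [CommRing A] {v v' : Fin n → A}
    (h : ∀ k : Fin n, esymmOf v ((k : ℕ) + 1) = esymmOf v' ((k : ℕ) + 1)) :
    ∏ i, (X - C (v i)) = ∏ i, (X - C (v' i)) := by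
  have expand : ∀ v : Fin n → A, ∏ i, (X - C (v i)) =
      ∑ j ∈ Finset.range (n + 1), (-1) ^ j * (C (esymmOf v j) * X ^ (n - j)) := by
    intro v
    have := Multiset.prod_X_sub_X_eq_sum_esymm ((Finset.univ : Finset (Fin n)).val.map v)
    simp only [Multiset.card_map, Multiset.map_map, Function.comp_def, Finset.esymm_map_val,
      Finset.card_val, Finset.card_fin] at this
    exact this
  rw [expand, expand]
  refine Finset.sum_congr rfl fun j hj => ?_
  have : esymmOf v j = esymmOf v' j := by
    rcases j with _ | k
    · simp [esymmOf]
    · exact h ⟨k, by simpa using hj⟩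
  rw [this]

lemma esymmOf_card {n : ℕ} {A : Type*} [CommRing A] (v : Fin n → A) :
    esymmOf v n = ∏ i, v i := by
  have : Finset.powersetCard n (Finset.univ : Finset (Fin n)) = {Finset.univ} := by
    have := Finset.powersetCard_self (Finset.univ : Finset (Fin n))
    rwa [Finset.card_fin] at this
  rw [esymmOf, this, Finset.sum_singleton]

lemma esymmOf_comp_perm {n : ℕ} {A : Type*} [CommRing A] (v : Fin n → A)
    (w : Equiv.Perm (Fin n)) (k : ℕ) : esymmOf (fun i => v (w i)) k = esymmOf v k := by
  rw [esymmOf, esymmOf, ← Finset.esymm_map_val, ← Finset.esymm_map_val]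
  congr 1
  conv_rhs => rw [← Multiset.map_univ_val_equiv w, Multiset.map_map]
  rfl

lemma map_esymmOf {ι A B : Type*} [Fintype ι] [CommRing A] [CommRing B] (f : A →+* B)
    (v : ι → A) (k : ℕ) : f (esymmOf v k) = esymmOf (fun i => f (v i)) k := by
  simp [esymmOf, map_sum, map_prod]

/-- The inclusion `ℤ[t^{±1}] → ℤ[t^{±1}, z^{±1}]`. -/
noncomputable def laurentInclusion (n : ℕ) : LaurentS n →+* LaurentR n :=
  AddMonoidAlgebra.mapDomainRingHom ℤ
    { toFun := fun a => Sum.elim a 0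
      map_zero' := by ext (i | i) <;> rfl
      map_add' := fun a b => by ext (i | i) <;> simp }

/-- The evaluation `tᵢ ↦ tᵢ`, `zᵢ ↦ t_{w(i)}` on `ℤ[t^{±1}, z^{±1}]`. -/
noncomputable def laurentEval {n : ℕ} (w : Equiv.Perm (Fin n)) : LaurentR n →+* LaurentS n :=
  AddMonoidAlgebra.mapDomainRingHom ℤ
    { toFun := fun a j => a (Sum.inl j) + a (Sum.inr (w.symm j))
      map_zero' := by ext; simp
      map_add' := fun a b => by ext; simp only [Pi.add_apply]; ring }

lemma laurentInclusion_single {n : ℕ} (a : Fin n → ℤ) (r : ℤ) :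
    laurentInclusion n (AddMonoidAlgebra.single a r) =
      AddMonoidAlgebra.single (Sum.elim a 0) r := by
  simp [laurentInclusion]

lemma laurentEval_single {n : ℕ} (w : Equiv.Perm (Fin n)) (a : Fin n ⊕ Fin n → ℤ) (r : ℤ) :
    laurentEval w (AddMonoidAlgebra.single a r) =
      AddMonoidAlgebra.single (fun j => a (Sum.inl j) + a (Sum.inr (w.symm j))) r := by
  simp [laurentEval]

lemma laurentInclusion_tS {n : ℕ} (i : Fin n) : laurentInclusion n (tS i) = tR i := by
  rw [tS, tR, laurentInclusion_single]
  congr 1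
  ext (j | j) <;> simp [Pi.single_apply]

lemma laurentEval_tR {n : ℕ} (w : Equiv.Perm (Fin n)) (i : Fin n) :
    laurentEval w (tR i) = tS i := by
  rw [tS, tR, laurentEval_single]
  congr 1
  ext j
  simp [Pi.single_apply]

lemma laurentEval_zR {n : ℕ} (w : Equiv.Perm (Fin n)) (i : Fin n) :
    laurentEval w (zR i) = tS (w i) := by
  rw [tS, zR, laurentEval_single]
  congr 1
  ext j
  simp [Pi.single_apply, Equiv.symm_apply_eq]

lemma laurentEval_laurentInclusion {n : ℕ} (w : Equiv.Perm (Fin n)) (s : LaurentS n) :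
    laurentEval w (laurentInclusion n s) = s := by
  suffices h : (laurentEval w).comp (laurentInclusion n) = RingHom.id _ from
    RingHom.congr_fun h s
  have single (m : Fin n → ℤ) (r : ℤ) : laurentEval w (laurentInclusion n (.single m r)) =
      .single m r := by
    simp only [laurentInclusion_single, laurentEval_single, Sum.elim_inl, Sum.elim_inr,
      Pi.zero_apply, add_zero]
  exact AddMonoidAlgebra.ringHom_ext (fun r => single 0 r) fun m => single m 1

lemma tS_injective {n : ℕ} : Function.Injective (tS : Fin n → LaurentS n) := by
  intro i j hij
  by_contra hne
  have := congrFun (AddMonoidAlgebra.single_left_injective (one_ne_zero (α := ℤ)) hij) i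
  simp [hne] at this

lemma borelIdealK_le_ker {n : ℕ} (w : Equiv.Perm (Fin n)) :
    borelIdealK n ≤ RingHom.ker (laurentEval w) := by
  refine Ideal.span_le.2 ?_
  rintro _ ⟨k, rfl⟩
  rw [SetLike.mem_coe, RingHom.mem_ker, map_sub, map_esymmOf, map_esymmOf, sub_eq_zero]
  simp only [laurentEval_tR, laurentEval_zR]
  exact esymmOf_comp_perm tS w _

lemma esymmOf_zR_quotient_eq {n : ℕ} (k : Fin n) :
    esymmOf (fun i => Ideal.Quotient.mk (borelIdealK n) (zR i)) ((k : ℕ) + 1) =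
      esymmOf (fun i => Ideal.Quotient.mk (borelIdealK n) (tR i)) ((k : ℕ) + 1) := by
  rw [← map_esymmOf, ← map_esymmOf]
  exact Ideal.Quotient.eq.2 (Ideal.subset_span ⟨k, rfl⟩)

/-- A subring containing the images of all Laurent variables and their inverses contains the image
of the whole Laurent polynomial ring. -/
lemma map_mem_subring_of_single_mem {σ A : Type*} [Fintype σ] [DecidableEq σ] [CommRing A]
    (φ : AddMonoidAlgebra ℤ (σ → ℤ) →+* A) (B : Subring A)
    (hpos : ∀ i, φ (AddMonoidAlgebra.single (Pi.single i 1) 1) ∈ B)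
    (hneg : ∀ i, φ (AddMonoidAlgebra.single (Pi.single i (-1)) 1) ∈ B)
    (f : AddMonoidAlgebra ℤ (σ → ℤ)) : φ f ∈ B := by
  let M : AddSubmonoid (σ → ℤ) :=
    { carrier := {a | φ (AddMonoidAlgebra.single a 1) ∈ B}
      zero_mem' := by
        change φ 1 ∈ B
        rw [map_one]
        exact B.one_mem
      add_mem' := fun {a b} ha hb => by
        change φ _ ∈ B
        rw [← one_mul (1 : ℤ), ← AddMonoidAlgebra.single_mul_single, map_mul]
        exact B.mul_mem ha hb }
  have hM : ∀ a, a ∈ M := by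
    intro a
    rw [← Finset.univ_sum_single a]
    refine M.sum_mem fun i _ => ?_
    rcases Int.eq_nat_or_neg (a i) with ⟨m, hm | hm⟩
    · have := M.nsmul_mem (hpos i) m
      rwa [← Pi.single_smul, nsmul_eq_mul, mul_one, ← hm] at this
    · have := M.nsmul_mem (hneg i) m
      rwa [← Pi.single_smul, nsmul_eq_mul, mul_neg_one, ← hm] at this
  induction f using AddMonoidAlgebra.induction_on with
  | of a => exact hM a
  | add x y hx hy => rw [map_add]; exact B.add_mem hx hy
  | smul r x hx => rw [map_zsmul]; exact B.zsmul_mem hx r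

lemma single_mul_single_neg {σ : Type*} [DecidableEq σ] (i : σ) :
    (AddMonoidAlgebra.single (Pi.single i 1) 1 : AddMonoidAlgebra ℤ (σ → ℤ)) *
      AddMonoidAlgebra.single (Pi.single i (-1)) 1 = 1 := by
  rw [AddMonoidAlgebra.single_mul_single, ← Pi.single_add]
  simp [AddMonoidAlgebra.one_def]

/-- For `n ≥ 1`, the localization maps
`ev_w : ℤ[t^{±1},z^{±1}]/⟨eₖ(z) − eₖ(t)⟩ → ℤ[t^{±1}]` (induced by `tᵢ ↦ tᵢ`, `zᵢ ↦ t_{w(i)}`)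
are well defined, and the ring homomorphism `L : R/I → ∏_{w ∈ Sₙ} S` whose `w`-th component is
`ev_w` is injective. -/
theorem localization_injective_K (n : ℕ) (hn : 1 ≤ n) :
    ∃ ev : Equiv.Perm (Fin n) → (LaurentR n ⧸ borelIdealK n) →+* LaurentS n,
      IsLocalizationFamilyK n ev ∧
      Function.Injective
        (fun (x : LaurentR n ⧸ borelIdealK n) (w : Equiv.Perm (Fin n)) => ev w x) := by
  let π := Ideal.Quotient.mk (borelIdealK n)
  let ev : Equiv.Perm (Fin n) → (LaurentR n ⧸ borelIdealK n) →+* LaurentS n := fun w =>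
    Ideal.Quotient.lift (borelIdealK n) (laurentEval w) fun a ha => borelIdealK_le_ker w ha
  have ev_mk : ∀ w a, ev w (π a) = laurentEval w a := fun w a => Ideal.Quotient.lift_mk _ _ _
  refine ⟨ev, fun w i => ⟨(ev_mk w _).trans (laurentEval_tR w i),
    (ev_mk w _).trans (laurentEval_zR w i)⟩, ?_⟩
  let : Algebra (LaurentS n) (LaurentR n ⧸ borelIdealK n) :=
    (π.comp (laurentInclusion n)).toAlgebra
  have alg_eq : ∀ s, algebraMap (LaurentS n) (LaurentR n ⧸ borelIdealK n) s =
    π (laurentInclusion n s) := fun _ => rfl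
  have hgen : Algebra.adjoin (LaurentS n) (Set.range fun i => π (zR i)) = ⊤ := by
    set B := Algebra.adjoin (LaurentS n) (Set.range fun i => π (zR i)) with hB
    have hz : ∀ i, π (zR i) ∈ B := fun i => Algebra.subset_adjoin ⟨i, rfl⟩
    have hprod : ∏ i, π (zR i) = ∏ i, π (tR i) := by
      have := esymmOf_zR_quotient_eq (n := n) ⟨n - 1, by omega⟩
      simp only [Nat.sub_add_cancel hn] at this
      rwa [esymmOf_card, esymmOf_card] at this
    have ht : ∀ i (m : ℤ),
        π (AddMonoidAlgebra.single (Pi.single (Sum.inl i) m) 1) ∈ B := by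
      intro i m
      have := B.algebraMap_mem (AddMonoidAlgebra.single (Pi.single i m) 1)
      rw [alg_eq, laurentInclusion_single] at this
      convert this using 4
      ext (j | j) <;> simp [Pi.single_apply]
    refine Algebra.eq_top_iff.2 fun f => ?_
    obtain ⟨f, rfl⟩ := Ideal.Quotient.mk_surjective f
    refine map_mem_subring_of_single_mem π B.toSubring ?_ ?_ f
    · rintro (i | i)
      · exact ht i 1
      · exact hz i
    · rintro (i | i)
      · exact ht i (-1)
      · have hinv : π (zR i) * π (AddMonoidAlgebra.single (Pi.single (Sum.inr i) (-1)) 1) = 1 := by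
          rw [← map_mul, zR, single_mul_single_neg, map_one]
        have hT : (∏ j, π (tR j)) *
            ∏ j, π (AddMonoidAlgebra.single (Pi.single (Sum.inl j) (-1)) 1) = 1 := by
          rw [← Finset.prod_mul_distrib]
          refine Finset.prod_eq_one fun j _ => ?_
          rw [← map_mul, tR, single_mul_single_neg, map_one]
        rw [← hprod, ← Finset.mul_prod_erase _ _ (Finset.mem_univ i)] at hT
        have heq : π (AddMonoidAlgebra.single (Pi.single (Sum.inr i) (-1)) 1) =
            (∏ j ∈ Finset.univ.erase i, π (zR j)) *
              ∏ j, π (AddMonoidAlgebra.single (Pi.single (Sum.inl j) (-1)) 1) := by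
          refine left_inv_eq_right_inv ((mul_comm _ _).trans hinv) ?_
          rw [← mul_assoc, hT]
        rw [heq]
        exact B.mul_mem (B.prod_mem fun j _ => hz j) (B.prod_mem fun j _ => ht j (-1))
  intro f g hfg
  rw [← sub_eq_zero]
  refine eq_zero_of_forall_perm_eval_eq_zero (ev := ev) tS_injective (x := fun i => π (zR i))
    ?_ hgen (fun w s => ?_) (fun w i => ?_) fun w => ?_
  · simp only [alg_eq, laurentInclusion_tS]
    exact prod_X_sub_C_eq_of_esymmOf_eq esymmOf_zR_quotient_eq
  · rw [alg_eq, ev_mk, laurentEval_laurentInclusion]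
  · rw [ev_mk, laurentEval_zR]
  · rw [map_sub, sub_eq_zero]
    exact congrFun hfg w
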